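/- Let λ > 0 and let φ : 𝔨 → 𝔤 be an ℝ-linear map such that: (i) φ is injective and 𝔤 = φ(𝔨) ⊕ 𝔭 as real vector spaces; (ii) φ(X(0,z)) ∈ 𝔤⁻¹ for all z ∈ ℂ; (iii) the (1,0)-entry of φ(J_λ(X(0,z))) equals i times the (1,0)-entry of φ(X(0,z)) for all z ∈ ℂ; (iv) [φ(X), φ(Y)] - φ([X,Y]) ∈ 𝔤¹ for all X, Y ∈ 𝔨, and [φ(X), φ(Y)] - φ([X,Y]) = 0 whenever X, Y ∈ H_e. Then there exists g ∈ P such that φ(X) = g·φ_λ(X)·g⁻¹ for all X ∈ 𝔨; that is, φ_λ is uniquely determined by these four properties up to composition with the adjoint action of an element of P. -/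

import Mathlib

open Matrix Complex

noncomputable section

/-- The 3×3 matrix J with J₀₂ = J₁₁ = J₂₀ = 1 and all other entries 0. -/
def Jm : Matrix (Fin 3) (Fin 3) ℂ := !![0,0,1;0,1,0;1,0,0]

/-- The real Lie algebra 𝔤 = su(2,1) = {A : Aᴴ·J + J·A = 0, tr A = 0}. -/
def su21 : Set (Matrix (Fin 3) (Fin 3) ℂ) :=
  {A | Aᴴ * Jm + Jm * A = 0 ∧ A.trace = 0}

/-- The real Lie algebra 𝔨 = su(2). -/
def su2 : Set (Matrix (Fin 2) (Fin 2) ℂ) :=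
  {X | Xᴴ = -X ∧ X.trace = 0}

/-- The element X(t,z) of su(2), with rows (i·t, -conj z) and (z, -i·t). -/
def Xk (t : ℝ) (z : ℂ) : Matrix (Fin 2) (Fin 2) ℂ :=
  !![Complex.I * t, -(starRingEnd ℂ) z; z, -(Complex.I * t)]

/-- The complex structure J_λ on H_e in terms of z = u+iv:
J_λ(X(0,u+iv)) = X(0, -(1/λ)·v + i·λ·u), so `Jl l z` is the new complex parameter. -/
def Jl (l : ℝ) (z : ℂ) : ℂ := ((-(z.im) / l : ℝ) : ℂ) + Complex.I * ((l * z.re : ℝ) : ℂ)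

/-- The matrix φ_λ(X(t,u+iv)) from Theorem 3.3 of the paper. -/
def phiE (l t u v : ℝ) : Matrix (Fin 3) (Fin 3) ℂ :=
  !![(((1+l^2)/(4*l) : ℝ) : ℂ) * (Complex.I * t),
     -((((5-3*l^2)/(4*Real.sqrt l)) : ℝ) : ℂ) * u
       - ((((3-5*l^2)/(4*l*Real.sqrt l)) : ℝ) : ℂ) * (Complex.I * v),
     ((((-15+34*l^2-15*l^4)/(16*l^2)) : ℝ) : ℂ) * (Complex.I * t);
     ((Real.sqrt l : ℝ) : ℂ) * u + (((1/Real.sqrt l) : ℝ) : ℂ) * (Complex.I * v),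
     -((((1+l^2)/(2*l)) : ℝ) : ℂ) * (Complex.I * t),
     ((((5-3*l^2)/(4*Real.sqrt l)) : ℝ) : ℂ) * u
       - ((((3-5*l^2)/(4*l*Real.sqrt l)) : ℝ) : ℂ) * (Complex.I * v);
     Complex.I * t,
     -((Real.sqrt l : ℝ) : ℂ) * u + (((1/Real.sqrt l) : ℝ) : ℂ) * (Complex.I * v),
     (((1+l^2)/(4*l) : ℝ) : ℂ) * (Complex.I * t)]

/-- The ℝ-linear map φ_λ, written as a map on 2×2 matrices: for X ∈ su(2) we have
X = X(t,z) with t = (X₀₀).im and z = X₁₀, and φ_λ(X(t,u+iv)) = `phiE l t u v`. -/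
def phiMap (l : ℝ) (X : Matrix (Fin 2) (Fin 2) ℂ) : Matrix (Fin 3) (Fin 3) ℂ :=
  phiE l (X 0 0).im (X 1 0).re (X 1 0).im

/-- 𝔭 = {A ∈ 𝔤 : A₁₀ = A₂₀ = A₂₁ = 0}. -/
def pSub : Set (Matrix (Fin 3) (Fin 3) ℂ) :=
  {A ∈ su21 | A 1 0 = 0 ∧ A 2 0 = 0 ∧ A 2 1 = 0}

/-- 𝔤⁻¹ = {A ∈ 𝔤 : A₂₀ = 0}. -/
def film1 : Set (Matrix (Fin 3) (Fin 3) ℂ) := {A ∈ su21 | A 2 0 = 0}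

/-- 𝔤¹ = {A ∈ 𝔤 : A₀₀ = A₁₁ = A₂₂ = A₁₀ = A₂₀ = A₂₁ = 0}. -/
def fil1 : Set (Matrix (Fin 3) (Fin 3) ℂ) :=
  {A ∈ su21 | A 0 0 = 0 ∧ A 1 1 = 0 ∧ A 2 2 = 0 ∧ A 1 0 = 0 ∧ A 2 0 = 0 ∧ A 2 1 = 0}

def e0 : Fin 3 → ℂ := ![1, 0, 0]

/-- The parabolic P : the stabilizer in SU(2,1) of the line ℂ·e₀. -/
def Pgrp : Set (Matrix (Fin 3) (Fin 3) ℂ) :=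
  {g | gᴴ * Jm * g = Jm ∧ g.det = 1 ∧ ∃ c : ℂ, g.mulVec e0 = c • e0}

lemma apply_of_mem_su21 {A : Matrix (Fin 3) (Fin 3) ℂ} (hA : A ∈ su21) :
    A 2 1 = -star (A 1 0) ∧ A 2 2 = -star (A 0 0) ∧ A 1 2 = -star (A 0 1) ∧
      A 1 1 = star (A 0 0) - A 0 0 ∧ (A 2 0).re = 0 ∧ (A 0 2).re = 0 := by
  obtain ⟨h, ht⟩ := hA
  have e := fun i j => congrFun (congrFun h i) j
  have e00 := e 0 0
  have e01 := e 0 1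
  have e02 := e 0 2
  have e12 := e 1 2
  have e22 := e 2 2
  simp [Jm, Matrix.mul_apply, Matrix.vecMul, dotProduct, Fin.sum_univ_three, Complex.ext_iff]
    at e00 e01 e02 e12 e22
  simp [Matrix.trace, Fin.sum_univ_three, Complex.ext_iff] at ht
  simp only [Complex.ext_iff, Complex.star_def, neg_re, neg_im, conj_re, conj_im, sub_re, sub_im]
  refine ⟨⟨?_, ?_⟩, ⟨?_, ?_⟩, ⟨?_, ?_⟩, ⟨?_, ?_⟩, ?_, ?_⟩ <;> linarith

lemma zero_mem_su21 : (0 : Matrix (Fin 3) (Fin 3) ℂ) ∈ su21 := by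
  simp [su21]

namespace Pgrp

variable {g h A : Matrix (Fin 3) (Fin 3) ℂ}

lemma isUnit_det (hg : g ∈ Pgrp) : IsUnit g.det := by
  rw [hg.2.1]; exact isUnit_one

lemma mul_inv (hg : g ∈ Pgrp) : g * g⁻¹ = 1 := Matrix.mul_nonsing_inv _ (isUnit_det hg)

lemma inv_mul (hg : g ∈ Pgrp) : g⁻¹ * g = 1 := Matrix.nonsing_inv_mul _ (isUnit_det hg)

lemma mul_mem (hg : g ∈ Pgrp) (hh : h ∈ Pgrp) : g * h ∈ Pgrp := by
  obtain ⟨h1, h2, c, h3⟩ := hg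
  obtain ⟨k1, k2, d, k3⟩ := hh
  refine ⟨?_, by rw [det_mul, h2, k2, one_mul], d * c, ?_⟩
  · rw [conjTranspose_mul]
    calc hᴴ * gᴴ * Jm * (g * h) = hᴴ * (gᴴ * Jm * g) * h := by simp only [Matrix.mul_assoc]
      _ = Jm := by rw [h1, k1]
  · rw [← mulVec_mulVec, k3, mulVec_smul, h3, smul_smul]

lemma inv_mem (hg : g ∈ Pgrp) : g⁻¹ ∈ Pgrp := by
  have hmi := mul_inv hg
  have him := inv_mul hg
  obtain ⟨h1, h2, c, h3⟩ := hg
  have hc : e0 = c • g⁻¹.mulVec e0 := by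
    rw [← mulVec_smul, ← h3, mulVec_mulVec, him, one_mulVec]
  have hc0 : c ≠ 0 := by
    rintro rfl
    simpa [e0] using congrFun hc 0
  refine ⟨?_, ?_, c⁻¹, ?_⟩
  · have hstar : g⁻¹ᴴ * gᴴ = 1 := by rw [← conjTranspose_mul, hmi, conjTranspose_one]
    calc g⁻¹ᴴ * Jm * g⁻¹ = g⁻¹ᴴ * (gᴴ * Jm * g) * g⁻¹ := by rw [h1]
      _ = (g⁻¹ᴴ * gᴴ) * Jm * (g * g⁻¹) := by simp only [Matrix.mul_assoc]
      _ = Jm := by rw [hstar, hmi, Matrix.one_mul, Matrix.mul_one]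
  · rw [det_nonsing_inv, h2, Ring.inverse_one]
  · conv_rhs => rw [hc]
    rw [smul_smul, inv_mul_cancel₀ hc0, one_smul]

lemma upper_triangular (hg : g ∈ Pgrp) : g 1 0 = 0 ∧ g 2 0 = 0 ∧ g 2 1 = 0 := by
  obtain ⟨h1, h2, c, h3⟩ := hg
  have h10 : g 1 0 = 0 := by
    simpa [e0, mulVec, dotProduct, Fin.sum_univ_three] using congrFun h3 1
  have h20 : g 2 0 = 0 := by
    simpa [e0, mulVec, dotProduct, Fin.sum_univ_three] using congrFun h3 2
  refine ⟨h10, h20, ?_⟩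
  have e01 := congrFun (congrFun h1 0) 1
  simp [Jm, Matrix.mul_apply, Fin.sum_univ_three, h10, h20] at e01
  refine e01.resolve_left fun h00 => ?_
  simp [det_fin_three, h10, h20, h00] at h2

lemma conj_mem_su21 (hg : g ∈ Pgrp) (hA : A ∈ su21) : g * A * g⁻¹ ∈ su21 := by
  have hmi := mul_inv hg
  have him := inv_mul hg
  have hgi := inv_mem hg
  obtain ⟨h1, h2, -⟩ := hg
  obtain ⟨k1, k2⟩ := hA
  have hstar : gᴴ * g⁻¹ᴴ = 1 := by rw [← conjTranspose_mul, him, conjTranspose_one]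
  have hJ₁ : gᴴ * Jm = Jm * g⁻¹ := by
    rw [← Matrix.mul_one (gᴴ * Jm), ← hmi, ← Matrix.mul_assoc, h1]
  have hJ₂ : Jm * g = g⁻¹ᴴ * Jm := by
    rw [← Matrix.mul_one (g⁻¹ᴴ * Jm), ← him, ← Matrix.mul_assoc, hgi.1]
  refine ⟨?_, by rw [trace_mul_comm, ← Matrix.mul_assoc, him, Matrix.one_mul, k2]⟩
  calc (g * A * g⁻¹)ᴴ * Jm + Jm * (g * A * g⁻¹)
      = g⁻¹ᴴ * Aᴴ * (gᴴ * Jm) + (Jm * g) * A * g⁻¹ := by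
        simp only [conjTranspose_mul, Matrix.mul_assoc]
    _ = g⁻¹ᴴ * (Aᴴ * Jm + Jm * A) * g⁻¹ := by
        rw [hJ₁, hJ₂, Matrix.mul_add, Matrix.add_mul]
        simp only [Matrix.mul_assoc]
    _ = 0 := by rw [k1, Matrix.mul_zero, Matrix.zero_mul]

lemma conj_apply_two_zero (hg : g ∈ Pgrp) : (g * A * g⁻¹) 2 0 = g 2 2 * A 2 0 * g⁻¹ 0 0 := by
  obtain ⟨h10, h20, h21⟩ := upper_triangular hg
  obtain ⟨k10, k20, k21⟩ := upper_triangular (inv_mem hg)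
  simp [Matrix.mul_apply, Fin.sum_univ_three, *]

lemma conj_apply_one_zero (hg : g ∈ Pgrp) :
    (g * A * g⁻¹) 1 0 = (g 1 1 * A 1 0 + g 1 2 * A 2 0) * g⁻¹ 0 0 := by
  obtain ⟨h10, h20, h21⟩ := upper_triangular hg
  obtain ⟨k10, k20, k21⟩ := upper_triangular (inv_mem hg)
  simp [Matrix.mul_apply, Fin.sum_univ_three, *]

lemma conj_apply_zero_zero (hg : g ∈ Pgrp) :
    (g * A * g⁻¹) 0 0 = (g 0 0 * A 0 0 + g 0 1 * A 1 0 + g 0 2 * A 2 0) * g⁻¹ 0 0 := by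
  obtain ⟨h10, h20, h21⟩ := upper_triangular hg
  obtain ⟨k10, k20, k21⟩ := upper_triangular (inv_mem hg)
  simp [Matrix.mul_apply, Fin.sum_univ_three, *]

lemma inv_apply_zero_zero_mul (hg : g ∈ Pgrp) : g⁻¹ 0 0 * g 0 0 = 1 := by
  obtain ⟨h10, h20, h21⟩ := upper_triangular hg
  have h := congrFun (congrFun (inv_mul hg) 0) 0
  simpa [Matrix.mul_apply, Fin.sum_univ_three, h10, h20] using h

lemma conj_mem_fil1 (hg : g ∈ Pgrp) (hA : A ∈ fil1) : g * A * g⁻¹ ∈ fil1 := by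
  obtain ⟨h10, h20, h21⟩ := upper_triangular hg
  obtain ⟨k10, k20, k21⟩ := upper_triangular (inv_mem hg)
  obtain ⟨hA, a00, a11, a22, a10, a20, a21⟩ := hA
  refine ⟨conj_mem_su21 hg hA, ?_, ?_, ?_, ?_, ?_, ?_⟩ <;>
    simp [Matrix.mul_apply, Fin.sum_univ_three, *]

lemma apply_one_one_ne_zero (hg : g ∈ Pgrp) : g 1 1 ≠ 0 := by
  obtain ⟨h10, h20, h21⟩ := upper_triangular hg
  intro h
  have := hg.2.1
  simp [det_fin_three, h10, h20, h21, h] at this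

end Pgrp

/-- The images `U`, `V`, `T` of `X(0,1)`, `X(0,i)`, `X(1,0)` under a map satisfying the four
properties. -/
structure IsAdapted (l : ℝ) (U V T : Matrix (Fin 3) (Fin 3) ℂ) : Prop where
  memU : U ∈ su21
  memV : V ∈ su21
  memT : T ∈ su21
  U20 : U 2 0 = 0
  V20 : V 2 0 = 0
  U10 : U 1 0 ≠ 0
  V10 : (l : ℂ) * V 1 0 = Complex.I * U 1 0
  UV : U * V - V * U = -(2 : ℂ) • T
  TU : T * U - U * T + (2 : ℂ) • V ∈ fil1
  TV : T * V - V * T - (2 : ℂ) • U ∈ fil1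

namespace IsAdapted

variable {l : ℝ} {U V T : Matrix (Fin 3) (Fin 3) ℂ}

lemma conj (h : IsAdapted l U V T) {g : Matrix (Fin 3) (Fin 3) ℂ} (hg : g ∈ Pgrp) :
    IsAdapted l (g * U * g⁻¹) (g * V * g⁻¹) (g * T * g⁻¹) := by
  have him := Pgrp.inv_mul hg
  have hcomp (A B : Matrix (Fin 3) (Fin 3) ℂ) :
      g * A * g⁻¹ * (g * B * g⁻¹) = g * (A * B) * g⁻¹ := by
    calc _ = g * A * (g⁻¹ * g) * B * g⁻¹ := by simp only [Matrix.mul_assoc]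
      _ = _ := by rw [him, Matrix.mul_one]; simp only [Matrix.mul_assoc]
  have hi0 : g⁻¹ 0 0 ≠ 0 := left_ne_zero_of_mul_eq_one (Pgrp.inv_apply_zero_zero_mul hg)
  refine ⟨Pgrp.conj_mem_su21 hg h.memU, Pgrp.conj_mem_su21 hg h.memV,
    Pgrp.conj_mem_su21 hg h.memT, ?_, ?_, ?_, ?_, ?_, ?_, ?_⟩
  · rw [Pgrp.conj_apply_two_zero hg, h.U20]; ring
  · rw [Pgrp.conj_apply_two_zero hg, h.V20]; ring
  · rw [Pgrp.conj_apply_one_zero hg, h.U20, mul_zero, add_zero]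
    exact mul_ne_zero (mul_ne_zero (Pgrp.apply_one_one_ne_zero hg) h.U10) hi0
  · rw [Pgrp.conj_apply_one_zero hg, Pgrp.conj_apply_one_zero hg, h.U20, h.V20]
    linear_combination (g 1 1 * g⁻¹ 0 0) * h.V10
  · rw [hcomp, hcomp, ← Matrix.sub_mul, ← Matrix.mul_sub, h.UV, Matrix.mul_smul, Matrix.smul_mul]
  · have := Pgrp.conj_mem_fil1 hg h.TU
    simpa only [hcomp, Matrix.mul_add, Matrix.add_mul, Matrix.mul_sub, Matrix.sub_mul,
      Matrix.mul_smul, Matrix.smul_mul] using this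
  · have := Pgrp.conj_mem_fil1 hg h.TV
    simpa only [hcomp, Matrix.mul_add, Matrix.add_mul, Matrix.mul_sub, Matrix.sub_mul,
      Matrix.mul_smul, Matrix.smul_mul] using this

lemma T20 (h : IsAdapted l U V T) (hl : 0 < l) (hU : U 1 0 = (Real.sqrt l : ℂ)) :
    T 2 0 = Complex.I := by
  have hl0 : (l : ℂ) ≠ 0 := by exact_mod_cast hl.ne'
  have hs : (Real.sqrt l : ℂ) * (Real.sqrt l : ℂ) = l := by
    exact_mod_cast Real.mul_self_sqrt hl.le
  have h20 := congrFun (congrFun h.UV 2) 0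
  have hV := h.V10
  have hV' := congrArg star hV
  simp [Matrix.mul_apply, Fin.sum_univ_three, h.U20, h.V20,
    (apply_of_mem_su21 h.memU).1, (apply_of_mem_su21 h.memV).1, hU] at h20 hV hV'
  apply mul_left_cancel₀ hl0
  linear_combination ((l : ℂ) / 2) * h20 + (Real.sqrt l : ℂ) / 2 * hV
    - (Real.sqrt l : ℂ) / 2 * hV' + Complex.I * hs

end IsAdapted

lemma exists_diagonal_normalization (z : ℂ) (hz : z ≠ 0) (s : ℝ) (hs : 0 < s) :
    ∃ g ∈ Pgrp, g 1 2 = 0 ∧ g 1 1 * z * g⁻¹ 0 0 = s := by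
  have hs0 : (s : ℂ) ≠ 0 := by exact_mod_cast hs.ne'
  have hn : (‖z‖ : ℂ) ≠ 0 := by exact_mod_cast norm_ne_zero_iff.2 hz
  obtain ⟨c, hc⟩ := IsAlgClosed.exists_pow_nat_eq (z * ‖z‖ ^ 2 / s ^ 3) (n := 3) (by norm_num)
  have hc0 : c ≠ 0 := by
    rintro rfl
    have : z * ‖z‖ ^ 2 / s ^ 3 ≠ 0 := by positivity
    exact this (by simpa using hc.symm)
  have hcn : ‖c‖ = ‖z‖ / s := by
    refine (pow_left_inj₀ (norm_nonneg c) (by positivity) three_ne_zero).1 ?_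
    rw [← norm_pow, hc]
    simp only [norm_div, norm_mul, norm_pow, norm_real, norm_norm, Real.norm_of_nonneg hs.le]
    ring
  have hcc : star c * c = (‖z‖ / s) ^ 2 := by
    rw [Complex.star_def, Complex.conj_mul', hcn]; push_cast; rfl
  have hs0' : star c ≠ 0 := star_ne_zero.2 hc0
  have hg : !![c, 0, 0; 0, star c / c, 0; 0, 0, (star c)⁻¹] ∈ Pgrp := by
    refine ⟨?_, ?_, c, ?_⟩
    · ext i j
      fin_cases i <;> fin_cases j <;>
        simp [Jm, Matrix.mul_apply, Fin.sum_univ_three, hc0]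
    · simp [det_fin_three]
      field_simp
      exact div_self hs0'
    · ext i
      fin_cases i <;> simp [e0]
  refine ⟨_, hg, by simp, ?_⟩
  have hi := Pgrp.inv_apply_zero_zero_mul hg
  simp only [of_apply, cons_val_zero, cons_val_one] at hi ⊢
  rw [eq_div_of_mul_eq hc0 hi]
  have : star c * c * z = s * c ^ 3 := by
    rw [hcc, hc]; field_simp
  simp only [Complex.star_def] at this ⊢
  field_simp
  apply mul_left_cancel₀ hc0
  linear_combination this

lemma exists_unipotent_normalization (a b : ℂ) :
    ∃ g ∈ Pgrp, g 1 1 = 1 ∧ g⁻¹ 0 0 = 1 ∧ b + g 1 2 * Complex.I = 0 ∧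
      (g 0 0 * a + g 0 1 * b + g 0 2 * Complex.I).re = 0 := by
  set w : ℂ := star (-Complex.I * b) with hw
  set r : ℝ := (a + w * b).re with hr
  have hg : !![1, w, Complex.I * r - w * star w / 2; 0, 1, -star w; 0, 0, 1] ∈ Pgrp := by
    refine ⟨?_, by simp [det_fin_three], 1, ?_⟩
    · ext i j
      fin_cases i <;> fin_cases j <;>
        simp [Jm, Matrix.mul_apply, Fin.sum_univ_three]
      rw [Complex.conj_ofNat]
      ring
    · ext i
      fin_cases i <;> simp [e0]
  refine ⟨_, hg, by simp, ?_, ?_, ?_⟩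
  · simpa using Pgrp.inv_apply_zero_zero_mul hg
  · simp [hw, ← mul_assoc]
    linear_combination b * Complex.I_sq
  · simp [hr]
    ring

lemma IsAdapted.exists_normalization {l : ℝ} {U V T : Matrix (Fin 3) (Fin 3) ℂ}
    (h : IsAdapted l U V T) (hl : 0 < l) :
    ∃ g ∈ Pgrp, (g * U * g⁻¹) 1 0 = (Real.sqrt l : ℂ) ∧ (g * T * g⁻¹) 1 0 = 0 ∧
      ((g * T * g⁻¹) 0 0).re = 0 := by
  obtain ⟨d, hd, hd12, hdU⟩ :=
    exists_diagonal_normalization (U 1 0) h.U10 (Real.sqrt l) (Real.sqrt_pos.2 hl)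
  have hdU' : (d * U * d⁻¹) 1 0 = (Real.sqrt l : ℂ) := by
    rw [Pgrp.conj_apply_one_zero hd, hd12, zero_mul, add_zero, hdU]
  have hT20 := (h.conj hd).T20 hl hdU'
  obtain ⟨n, hn, hn11, hni, hn10, hn00⟩ :=
    exists_unipotent_normalization ((d * T * d⁻¹) 0 0) ((d * T * d⁻¹) 1 0)
  have hcomp (A : Matrix (Fin 3) (Fin 3) ℂ) :
      n * d * A * (n * d)⁻¹ = n * (d * A * d⁻¹) * n⁻¹ := by
    rw [Matrix.mul_inv_rev]; simp only [Matrix.mul_assoc]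
  refine ⟨n * d, Pgrp.mul_mem hn hd, ?_, ?_, ?_⟩
  · rw [hcomp, Pgrp.conj_apply_one_zero hn, hn11, hni, hdU', (h.conj hd).U20]; ring
  · rw [hcomp, Pgrp.conj_apply_one_zero hn, hn11, hni, hT20, one_mul, hn10, zero_mul]
  · rw [hcomp, Pgrp.conj_apply_zero_zero hn, hni, hT20, mul_one, hn00]

lemma IsAdapted.eq_phiE {l : ℝ} {U V T : Matrix (Fin 3) (Fin 3) ℂ}
    (h : IsAdapted l U V T) (hl : 0 < l) (hU : U 1 0 = (Real.sqrt l : ℂ)) (hT10 : T 1 0 = 0)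
    (hT00 : (T 0 0).re = 0) :
    U = phiE l 0 1 0 ∧ V = phiE l 0 0 1 ∧ T = phiE l 1 0 0 := by
  have hT20 := h.T20 hl hU
  obtain ⟨s, hs, rfl⟩ : ∃ s : ℝ, 0 < s ∧ l = s ^ 2 :=
    ⟨Real.sqrt l, Real.sqrt_pos.2 hl, (Real.sq_sqrt hl.le).symm⟩
  rw [Real.sqrt_sq hs.le] at hU
  have hs0 : (s : ℂ) ≠ 0 := by exact_mod_cast hs.ne'
  have hV : V 1 0 = ((s⁻¹ : ℝ) : ℂ) * Complex.I := by
    have := h.V10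
    rw [hU] at this
    push_cast at this ⊢
    field_simp
    apply mul_left_cancel₀ hs0
    linear_combination this
  obtain ⟨U21, U22, U12, U11, -, U02⟩ := apply_of_mem_su21 h.memU
  obtain ⟨V21, V22, V12, V11, -, V02⟩ := apply_of_mem_su21 h.memV
  obtain ⟨T21, T22, T12, T11, -, T02⟩ := apply_of_mem_su21 h.memT
  have e := fun i j => congrFun (congrFun h.UV i) j
  have e10 := e 1 0
  have e00 := e 0 0
  have e02 := e 0 2
  obtain ⟨-, tu00, -, -, tu10, tu20, -⟩ := h.TU
  obtain ⟨-, tv00, -, -, tv10, tv20, -⟩ := h.TV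
  simp [Matrix.mul_apply, Fin.sum_univ_three, h.U20, h.V20, hT20, hT10, hU, hV, U21, U22, U12, U11,
    V21, V22, V12, V11, T21, T22, T12, T11, Complex.ext_iff, hT00, U02, V02, T02]
    at e10 e00 e02 tu00 tu10 tu20 tv00 tv10 tv20
  have hk : s * s⁻¹ = 1 := mul_inv_cancel₀ hs.ne'
  have hk0 : s⁻¹ ≠ 0 := inv_ne_zero hs.ne'
  have U00i : (U 0 0).im = 0 := by
    have : s⁻¹ * (U 0 0).im = 0 := by linear_combination e10.1 / 3 - s / 3 * tv20
    exact (mul_eq_zero.1 this).resolve_left hk0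
  have V00i : (V 0 0).im = 0 := by
    have : s * (V 0 0).im = 0 := by linear_combination e10.2 / 3 + s⁻¹ / 3 * tu20
    exact (mul_eq_zero.1 this).resolve_left hs.ne'
  simp only [U00i, V00i, tu20, tv20] at e00 e02 tu00 tv00
  have T01i : (T 0 1).im = 0 := by
    have : (T 0 1).im * s = 0 := by linear_combination tu00.2
    exact (mul_eq_zero.1 this).resolve_right hs.ne'
  have T01r : (T 0 1).re = 0 := by
    have : (T 0 1).re * s⁻¹ = 0 := by linear_combination tv00.2
    exact (mul_eq_zero.1 this).resolve_right hk0
  have U02i : (U 0 2).im = 0 := by linear_combination tu00.1 - s * T01r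
  have V02i : (V 0 2).im = 0 := by linear_combination tv00.1 + s⁻¹ * T01i
  have T00i : (T 0 0).im = (s ^ 2 + s⁻¹ ^ 2) / 4 := by
    linear_combination e00.2 / 8 - s⁻¹ / 8 * tu10.2 + s / 8 * tv10.1 - 6 / 8 * (T 0 0).im * hk
  have U01r : (U 0 1).re = 3 * (T 0 0).im * s - 2 * s⁻¹ := by linear_combination tu10.2
  have V01i : (V 0 1).im = 2 * s - 3 * (T 0 0).im * s⁻¹ := by linear_combination tv10.1
  have T02i : (T 0 2).im = -((U 0 1).re * (V 0 1).im) := by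
    rw [tu10.1, tv10.2] at e02
    linear_combination e02.2 / 2
  rw [U01r, V01i] at T02i
  rw [T00i] at U01r V01i T02i
  refine ⟨?_, ?_, ?_⟩ <;> ext i j <;> fin_cases i <;> fin_cases j <;> apply Complex.ext <;>
    simp [phiE, h.U20, h.V20, hT20, hT10, hU, hV, U21, U22, U12, U11, V21, V22, V12, V11,
      T21, T22, T12, T11, hT00, U02, V02, T02, tu10.1, tu20, tv10.2, tv20, U00i, V00i, T01i, T01r,
      U02i, V02i, T00i, U01r, V01i, T02i, Real.sqrt_sq hs.le, -ofReal_div, -ofReal_sub, -ofReal_mul, -ofReal_add,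
      -ofReal_neg, -ofReal_pow, -ofReal_inv, -one_div] <;>
    field_simp <;> ring

lemma phiE_eq_smul_add (l t u v : ℝ) :
    phiE l t u v = (t : ℂ) • phiE l 1 0 0 + (u : ℂ) • phiE l 0 1 0 + (v : ℂ) • phiE l 0 0 1 := by
  ext i j
  fin_cases i <;> fin_cases j <;> simp [phiE] <;> ring

lemma Xk_mem_su2 (t : ℝ) (z : ℂ) : Xk t z ∈ su2 := by
  refine ⟨?_, by simp [Xk, Matrix.trace]⟩
  ext i j
  fin_cases i <;> fin_cases j <;> simp [Xk]

lemma eq_Xk_smul_add_of_mem_su2 {X : Matrix (Fin 2) (Fin 2) ℂ} (hX : X ∈ su2) :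
    X = (X 0 0).im • Xk 1 0 + (X 1 0).re • Xk 0 1 + (X 1 0).im • Xk 0 Complex.I := by
  obtain ⟨h, ht⟩ := hX
  have h00 := congrFun (congrFun h 0) 0
  have h01 := congrFun (congrFun h 0) 1
  simp [Complex.ext_iff] at h00 h01
  simp [Matrix.trace, Complex.ext_iff] at ht
  ext i j
  fin_cases i <;> fin_cases j <;> simp [Xk, Complex.ext_iff] <;>
    grind

/-- any ℝ-linear map φ : 𝔨 → 𝔤 with the four properties of Theorem 3.3
agrees on 𝔨 with Ad(g) ∘ φ_λ for some g ∈ P. -/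
theorem stmt18 (l : ℝ) (hl : 0 < l)
    (φ : Matrix (Fin 2) (Fin 2) ℂ →ₗ[ℝ] Matrix (Fin 3) (Fin 3) ℂ)
    (hval : ∀ X ∈ su2, φ X ∈ su21)
    (hinj : ∀ X ∈ su2, ∀ Y ∈ su2, φ X = φ Y → X = Y)
    (hsum : ∀ A ∈ su21, ∃! q : su2 × pSub,
      A = φ (q.1 : Matrix (Fin 2) (Fin 2) ℂ) + (q.2 : Matrix (Fin 3) (Fin 3) ℂ))
    (hHe : ∀ z : ℂ, φ (Xk 0 z) ∈ film1)
    (hJ : ∀ z : ℂ, (φ (Xk 0 (Jl l z))) 1 0 = Complex.I * (φ (Xk 0 z)) 1 0)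
    (hcurv : ∀ X ∈ su2, ∀ Y ∈ su2,
      φ X * φ Y - φ Y * φ X - φ (X * Y - Y * X) ∈ fil1)
    (hflat : ∀ z z' : ℂ,
      φ (Xk 0 z) * φ (Xk 0 z') - φ (Xk 0 z') * φ (Xk 0 z)
        - φ (Xk 0 z * Xk 0 z' - Xk 0 z' * Xk 0 z) = 0) :
    ∃ g ∈ Pgrp, ∀ X ∈ su2, φ X = g * phiMap l X * g⁻¹ := by
  set U := φ (Xk 0 1) with hUdef
  set V := φ (Xk 0 Complex.I)
  set T := φ (Xk 1 0)
  have hUV : Xk 0 1 * Xk 0 Complex.I - Xk 0 Complex.I * Xk 0 1 = (-2 : ℝ) • Xk 1 0 := by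
    ext i j
    fin_cases i <;> fin_cases j <;> simp [Xk] <;> ring
  have hTU : Xk 1 0 * Xk 0 1 - Xk 0 1 * Xk 1 0 = (-2 : ℝ) • Xk 0 Complex.I := by
    ext i j
    fin_cases i <;> fin_cases j <;> simp [Xk] <;> ring
  have hTV : Xk 1 0 * Xk 0 Complex.I - Xk 0 Complex.I * Xk 1 0 = (2 : ℝ) • Xk 0 1 := by
    ext i j
    fin_cases i <;> fin_cases j <;> simp [Xk] <;> ring
  have hV10 : (l : ℂ) * V 1 0 = Complex.I * U 1 0 := by
    have hX : Xk 0 (Jl l 1) = l • Xk 0 Complex.I := by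
      ext i j
      fin_cases i <;> fin_cases j <;> simp [Xk, Jl] <;> ring
    simpa [hX] using hJ 1
  have hU10 : U 1 0 ≠ 0 := by
    intro h0
    have hUp : U ∈ pSub := by
      refine ⟨(hHe 1).1, h0, (hHe 1).2, ?_⟩
      have := (apply_of_mem_su21 (hHe 1).1).1
      rw [← hUdef, h0] at this
      simpa using this
    have h0p : (0 : Matrix (Fin 3) (Fin 3) ℂ) ∈ pSub := ⟨zero_mem_su21, by simp⟩
    have h0k : (0 : Matrix (Fin 2) (Fin 2) ℂ) ∈ su2 := by simp [su2]
    have key := (hsum U (hHe 1).1).unique (y₁ := (⟨Xk 0 1, Xk_mem_su2 0 1⟩, ⟨0, h0p⟩))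
      (y₂ := (⟨0, h0k⟩, ⟨U, hUp⟩)) (by simp [U]) (by simp)
    have := congrArg (fun q : su2 × pSub => (q.1 : Matrix (Fin 2) (Fin 2) ℂ) 1 0) key
    simp [Xk] at this
  have hA : IsAdapted l U V T := by
    refine ⟨(hHe 1).1, (hHe _).1, hval _ (Xk_mem_su2 _ _), (hHe 1).2, (hHe _).2, hU10, hV10,
      ?_, ?_, ?_⟩
    · have := hflat 1 Complex.I
      rw [hUV, map_smul, sub_eq_zero] at this
      rw [this]
      ext i j
      simp [T]
    · have := hcurv _ (Xk_mem_su2 1 0) _ (Xk_mem_su2 0 1)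
      rw [hTU, map_smul] at this
      convert this using 1
      ext i j
      simp [T, U, V]
    · have := hcurv _ (Xk_mem_su2 1 0) _ (Xk_mem_su2 0 Complex.I)
      rw [hTV, map_smul] at this
      convert this using 1
      ext i j
      simp [T, U, V]
  obtain ⟨g, hg, hgU, hgT, hgT'⟩ := hA.exists_normalization hl
  obtain ⟨eU, eV, eT⟩ := (hA.conj hg).eq_phiE hl hgU hgT hgT'
  have hback (A : Matrix (Fin 3) (Fin 3) ℂ) : g⁻¹ * (g * A * g⁻¹) * g⁻¹⁻¹ = A := by
    rw [Matrix.nonsing_inv_nonsing_inv _ (Pgrp.isUnit_det hg)]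
    calc _ = (g⁻¹ * g) * A * (g⁻¹ * g) := by simp only [Matrix.mul_assoc]
      _ = A := by rw [Pgrp.inv_mul hg, Matrix.one_mul, Matrix.mul_one]
  refine ⟨g⁻¹, Pgrp.inv_mem hg, fun X hX => ?_⟩
  rw [phiMap, phiE_eq_smul_add, ← eU, ← eV, ← eT]
  simp only [Matrix.mul_add, Matrix.add_mul, Matrix.mul_smul, Matrix.smul_mul, hback]
  conv_lhs => rw [eq_Xk_smul_add_of_mem_su2 hX]
  simp only [map_add, map_smul]
  rfl
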